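/- Let d ∈ ℕ, let 1 < r₁ < q < ∞ and let κ satisfy r₁/q ≤ κ ≤ 1. Then there exists a constant C > 0 such that for every Schwartz function u : ℝ^d → ℂ one has ‖u‖_q ≤ C · ‖⟨D⟩^{−d/q}u‖_∞^{1−κ} · ‖⟨D⟩^{d(1/r₁ − 1/q)}u‖_{r₁}^{κ}. -/

import Mathlib

open MeasureTheory Real SchwartzMap
open scoped FourierTransform ENNReal NNReal


namespace GNaux

variable {d : ℕ}

/-- Weak-type step of the level set argument. -/
lemma level_step {u g : EuclideanSpace ℝ (Fin d) → ℂ} (hg : Measurable g)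
    {lam a : ℝ} (hl : 0 < lam) (ha : 0 < a) (k : EuclideanSpace ℝ (Fin d) → ℝ≥0∞)
    (hk : Measurable k) (hkB : ∫⁻ y, k y ≤ ENNReal.ofReal (lam / a))
    (hu : ∀ x, ‖u x‖ₑ ≤ ENNReal.ofReal lam + ∫⁻ y, k y * ‖g (x - y)‖ₑ) :
    volume {x | lam < ‖u x‖ / 3} ≤
      ENNReal.ofReal a⁻¹ * ∫⁻ y, {y | a < ‖g y‖}.indicator (fun y => ‖g y‖ₑ) y := by
  set S : Set (EuclideanSpace ℝ (Fin d)) := {y | a < ‖g y‖} with hS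
  have hSm : MeasurableSet S := measurableSet_lt measurable_const hg.norm
  set G1 := S.indicator (fun y => ‖g y‖ₑ) with hG1
  have hG1m : Measurable G1 := hg.enorm.indicator hSm
  have hHm : Measurable (fun x => ∫⁻ y, k y * G1 (x - y)) := by
    apply Measurable.lintegral_prod_right' (f := fun p : EuclideanSpace ℝ (Fin d) × EuclideanSpace ℝ (Fin d) => k p.2 * G1 (p.1 - p.2))
    exact (hk.comp measurable_snd).mul (hG1m.comp (measurable_fst.sub measurable_snd))
  have hsub : {x | lam < ‖u x‖ / 3} ⊆ {x | ENNReal.ofReal lam ≤ ∫⁻ y, k y * G1 (x - y)} := by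
    intro x hx
    simp only [Set.mem_ofPred_eq] at hx ⊢
    have h1 : ENNReal.ofReal (lam + lam + lam) ≤ ‖u x‖ₑ := by
      rw [← ofReal_norm]
      apply ENNReal.ofReal_le_ofReal; linarith
    have h2 : ∫⁻ y, k y * ‖g (x - y)‖ₑ ≤ (∫⁻ y, k y * G1 (x - y)) + ENNReal.ofReal lam := by
      calc ∫⁻ y, k y * ‖g (x - y)‖ₑ ≤ ∫⁻ y, (k y * G1 (x - y) + k y * ENNReal.ofReal a) := by
            apply lintegral_mono
            intro y
            simp only
            rw [← mul_add]
            gcongr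
            by_cases hy : x - y ∈ S
            · simp [hG1, hy]
            · simp only [hG1, hy, not_false_eq_true, Set.indicator_of_notMem, zero_add]
              rw [← ofReal_norm]
              apply ENNReal.ofReal_le_ofReal
              simpa [hS] using hy
        _ = (∫⁻ y, k y * G1 (x - y)) + (∫⁻ y, k y) * ENNReal.ofReal a := by
            rw [lintegral_add_right _ (hk.mul_const _), lintegral_mul_const _ hk]
        _ ≤ _ := by
            gcongr
            calc (∫⁻ y, k y) * ENNReal.ofReal a ≤ ENNReal.ofReal (lam / a) * ENNReal.ofReal a := by gcongr
              _ = ENNReal.ofReal lam := by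
                rw [← ENNReal.ofReal_mul (by positivity)]; congr 1; field_simp
    have h3 := h1.trans ((hu x).trans (add_le_add_right h2 _))
    rw [ENNReal.ofReal_add (by positivity) hl.le, ENNReal.ofReal_add hl.le hl.le] at h3
    rw [← add_assoc] at h3
    have h4 := (ENNReal.add_le_add_iff_right ENNReal.ofReal_ne_top).1 h3
    exact (ENNReal.add_le_add_iff_left ENNReal.ofReal_ne_top).1 h4
  have hint : ∫⁻ x, ∫⁻ y, k y * G1 (x - y) = (∫⁻ y, k y) * ∫⁻ y, G1 y := by
    rw [lintegral_lintegral_swap]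
    · have : ∀ y, ∫⁻ x, k y * G1 (x - y) = k y * ∫⁻ x, G1 x := by
        intro y
        rw [lintegral_const_mul (f := fun x => G1 (x - y)) _ (hG1m.comp (measurable_id.sub_const y))]
        congr 1
        exact lintegral_sub_right_eq_self G1 y
      simp_rw [this]
      rw [lintegral_mul_const _ hk]
    · exact ((hk.comp measurable_snd).mul
        (hG1m.comp (measurable_fst.sub measurable_snd))).aemeasurable
  calc volume {x | lam < ‖u x‖ / 3} ≤ volume {x | ENNReal.ofReal lam ≤ ∫⁻ y, k y * G1 (x - y)} :=
        measure_mono hsub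
    _ ≤ (∫⁻ x, ∫⁻ y, k y * G1 (x - y)) / ENNReal.ofReal lam :=
        meas_ge_le_lintegral_div hHm.aemeasurable (by simpa using hl) ENNReal.ofReal_ne_top
    _ ≤ (ENNReal.ofReal (lam / a) * ∫⁻ y, G1 y) / ENNReal.ofReal lam := by
        rw [hint]; gcongr
    _ = _ := by
        rw [mul_comm, mul_div_assoc, mul_comm, ← ENNReal.ofReal_div_of_pos hl]
        congr 2; field_simp

/-- One-variable integral used in the level set argument. -/
lemma inner_int {q r c s : ℝ} (hr : 1 < r) (hq : r < q) (hc : 0 < c) (hs : 0 ≤ s) :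
    ∫⁻ lam in Set.Ioi (0:ℝ), (if c * lam ^ (q / r) < s then
      ENNReal.ofReal ((c * lam ^ (q / r))⁻¹ * lam ^ (q - 1)) else 0)
      ≤ ENNReal.ofReal (c⁻¹ * ((s / c) ^ (r - 1) / (q - q / r))) := by
  have hr0 : 0 < r := by linarith
  have hq0 : 0 < q := by linarith
  have he : 0 < q - q / r := by
    rw [sub_pos, div_lt_iff₀ hr0]; nlinarith
  set L := (s / c) ^ (r / q) with hL
  have hL0 : 0 ≤ L := by positivity
  have hLe : L ^ (q - q / r) = (s / c) ^ (r - 1) := by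
    rw [hL, ← Real.rpow_mul (by positivity)]; congr 1; field_simp
  have key : ∫⁻ lam in Set.Ioc (0:ℝ) L, ENNReal.ofReal (c⁻¹ * lam ^ (q - q / r - 1)) =
      ENNReal.ofReal (c⁻¹ * ((s / c) ^ (r - 1) / (q - q / r))) := by
    have hii : IntervalIntegrable (fun lam : ℝ => c⁻¹ * lam ^ (q - q / r - 1)) volume 0 L :=
      (intervalIntegral.intervalIntegrable_rpow' (by linarith)).const_mul _
    rw [← ofReal_integral_eq_lintegral_ofReal]
    · rw [← intervalIntegral.integral_of_le hL0, intervalIntegral.integral_const_mul,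
        integral_rpow (Or.inl (by linarith))]
      rw [sub_add_cancel, Real.zero_rpow he.ne', hLe, sub_zero]
    · exact (intervalIntegrable_iff_integrableOn_Ioc_of_le hL0).1 hii
    · filter_upwards [self_mem_ae_restrict measurableSet_Ioc] with x hx
      have := hx.1
      simp only [Pi.zero_apply]; positivity
  rw [← key, ← lintegral_indicator measurableSet_Ioi, ← lintegral_indicator measurableSet_Ioc]
  apply lintegral_mono
  intro x
  simp only [Set.indicator, Set.mem_Ioi, Set.mem_Ioc]
  by_cases hx : 0 < x
  · by_cases h2 : c * x ^ (q / r) < s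
    · have hxL : x ≤ L := by
        have : x ^ (q / r) ≤ s / c := by
          rw [le_div_iff₀ hc]; linarith
        calc x = (x ^ (q / r)) ^ (r / q) := by
              rw [← Real.rpow_mul hx.le]
              have : q / r * (r / q) = 1 := by field_simp
              rw [this, Real.rpow_one]
          _ ≤ L := by rw [hL]; gcongr
      simp only [hx, h2, hxL, if_true, and_self]
      apply le_of_eq
      congr 1
      rw [mul_inv, mul_assoc, ← Real.rpow_neg hx.le, ← Real.rpow_add hx]
      congr 2; ring
    · simp [h2]
  · simp [hx]

/-- Strong-type bound from the family of decompositions. -/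
lemma level_set {u g : EuclideanSpace ℝ (Fin d) → ℂ} (hum : Measurable u) (hg : Measurable g)
    {q r c : ℝ} (hr : 1 < r) (hq : r < q) (hc : 0 < c)
    (H : ∀ lam : ℝ, 0 < lam → ∃ k : EuclideanSpace ℝ (Fin d) → ℝ≥0∞, Measurable k ∧
      ∫⁻ y, k y ≤ ENNReal.ofReal (lam / (c * lam ^ (q / r))) ∧
      ∀ x, ‖u x‖ₑ ≤ ENNReal.ofReal lam + ∫⁻ y, k y * ‖g (x - y)‖ₑ) :
    ∫⁻ x, ‖u x‖ₑ ^ q ≤ ENNReal.ofReal (3 ^ q * (r / (r - 1)) * (c⁻¹) ^ r) * ∫⁻ x, ‖g x‖ₑ ^ r := by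
  have hr0 : 0 < r := by linarith
  have hq0 : 0 < q := by linarith
  have he : 0 < q - q / r := by
    rw [sub_pos, div_lt_iff₀ hr0]; nlinarith
  have h1 : ∫⁻ x, ‖u x‖ₑ ^ q = ENNReal.ofReal (3 ^ q) * ∫⁻ x, ENNReal.ofReal ((‖u x‖ / 3) ^ q) := by
    rw [← lintegral_const_mul _ (by fun_prop)]
    congr 1; ext x
    rw [← ENNReal.ofReal_mul (by positivity), ← ofReal_norm,
      ENNReal.ofReal_rpow_of_nonneg (norm_nonneg _) hq0.le, Real.div_rpow (norm_nonneg _) (by norm_num)]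
    congr 1; field_simp
  rw [h1, lintegral_rpow_eq_lintegral_meas_lt_mul volume
    (Filter.Eventually.of_forall fun x => by simp only [Pi.zero_apply]; positivity)
    (by fun_prop) hq0]
  have h2 : ∫⁻ t in Set.Ioi (0:ℝ), volume {a | t < ‖u a‖ / 3} * ENNReal.ofReal (t ^ (q - 1)) ≤
      ∫⁻ t in Set.Ioi (0:ℝ), ∫⁻ y, ‖g y‖ₑ * (if c * t ^ (q / r) < ‖g y‖ then
        ENNReal.ofReal ((c * t ^ (q / r))⁻¹ * t ^ (q - 1)) else 0) := by
    apply setLIntegral_mono' measurableSet_Ioi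
    intro t ht
    have ht : 0 < t := ht
    obtain ⟨k, hk, hkB, hku⟩ := H t ht
    have ha : 0 < c * t ^ (q / r) := by positivity
    have := level_step hg ht ha k hk hkB hku
    calc _ ≤ (ENNReal.ofReal (c * t ^ (q / r))⁻¹ *
          ∫⁻ y, {y | c * t ^ (q / r) < ‖g y‖}.indicator (fun y => ‖g y‖ₑ) y) *
            ENNReal.ofReal (t ^ (q - 1)) := by gcongr
      _ = ∫⁻ y, (ENNReal.ofReal (c * t ^ (q / r))⁻¹ * ENNReal.ofReal (t ^ (q - 1))) *
          {y | c * t ^ (q / r) < ‖g y‖}.indicator (fun y => ‖g y‖ₑ) y := by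
          rw [lintegral_const_mul _ (hg.enorm.indicator (measurableSet_lt measurable_const hg.norm))]
          ring
      _ ≤ _ := by
          apply lintegral_mono
          intro y
          simp only [Set.indicator, Set.mem_ofPred_eq]
          split_ifs
          · rw [← ENNReal.ofReal_mul (by positivity), mul_comm]
          · simp
  have h3 : ∫⁻ t in Set.Ioi (0:ℝ), ∫⁻ y, ‖g y‖ₑ * (if c * t ^ (q / r) < ‖g y‖ then
        ENNReal.ofReal ((c * t ^ (q / r))⁻¹ * t ^ (q - 1)) else 0) ≤
      ∫⁻ y, ENNReal.ofReal (c⁻¹ ^ r / (q - q / r)) * ‖g y‖ₑ ^ r := by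
    rw [lintegral_lintegral_swap]
    · apply lintegral_mono
      intro y
      simp only
      rw [lintegral_const_mul]
      · calc _ ≤ ‖g y‖ₑ * ENNReal.ofReal (c⁻¹ * ((‖g y‖ / c) ^ (r - 1) / (q - q / r))) := by
              gcongr; exact inner_int hr hq hc (norm_nonneg _)
          _ = _ := by
              rw [← ofReal_norm, ← ENNReal.ofReal_mul (norm_nonneg _),
                ENNReal.ofReal_rpow_of_nonneg (norm_nonneg _) hr0.le,
                ← ENNReal.ofReal_mul (by positivity)]
              congr 1
              by_cases h0 : ‖g y‖ = 0
              · rw [h0, Real.zero_rpow hr0.ne']; simp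
              have hp : 0 < ‖g y‖ := lt_of_le_of_ne (norm_nonneg _) (Ne.symm h0)
              rw [Real.div_rpow hp.le hc.le, Real.rpow_sub_one hp.ne', Real.rpow_sub_one hc.ne',
                Real.inv_rpow hc.le]
              field_simp
      · apply Measurable.ite
        · exact measurableSet_lt (by fun_prop) measurable_const
        · fun_prop
        · fun_prop
    · apply Measurable.aemeasurable
      apply Measurable.mul
      · fun_prop
      · apply Measurable.ite
        · exact measurableSet_lt (by fun_prop) (by fun_prop)
        · fun_prop
        · fun_prop
  calc _ ≤ ENNReal.ofReal (3 ^ q) * (ENNReal.ofReal q *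
        ∫⁻ y, ENNReal.ofReal (c⁻¹ ^ r / (q - q / r)) * ‖g y‖ₑ ^ r) := by
        gcongr; exact h2.trans h3
    _ = _ := by
        rw [lintegral_const_mul _ (by fun_prop), ← mul_assoc, ← mul_assoc,
          ← ENNReal.ofReal_mul (by positivity), ← ENNReal.ofReal_mul (by positivity)]
        congr 2
        have : r - 1 ≠ 0 := by linarith
        have h5 : q - q / r = q * (r - 1) / r := by field_simp
        rw [h5]
        field_simp

end GNaux


namespace GNaux

variable {d : ℕ}

/-- The heat kernel with Fourier transform `exp (-t ‖ξ‖²)`. -/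
noncomputable def heat (t : ℝ) (x : EuclideanSpace ℝ (Fin d)) : ℝ :=
  (π / t) ^ ((d : ℝ) / 2) * rexp (-(π ^ 2 / t) * ‖x‖ ^ 2)

lemma heat_nonneg {t : ℝ} (ht : 0 < t) (x : EuclideanSpace ℝ (Fin d)) : 0 ≤ heat t x := by
  unfold heat; positivity

lemma heat_le {t : ℝ} (ht : 0 < t) (x : EuclideanSpace ℝ (Fin d)) :
    heat t x ≤ (π / t) ^ ((d : ℝ) / 2) := by
  unfold heat
  apply mul_le_of_le_one_right (by positivity)
  rw [Real.exp_le_one_iff]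
  have : 0 ≤ π ^ 2 / t * ‖x‖ ^ 2 := by positivity
  linarith

lemma heat_integral {t : ℝ} (ht : 0 < t) : ∫ x : EuclideanSpace ℝ (Fin d), heat t x = 1 := by
  unfold heat
  rw [integral_const_mul, GaussianFourier.integral_rexp_neg_mul_sq_norm (by positivity)]
  rw [finrank_euclideanSpace_fin, ← Real.mul_rpow (by positivity) (by positivity)]
  have : π / t * (π / (π ^ 2 / t)) = 1 := by field_simp
  rw [this, Real.one_rpow]

lemma heat_integrable {t : ℝ} (ht : 0 < t) :
    Integrable (fun x : EuclideanSpace ℝ (Fin d) => heat t x) := by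
  apply Integrable.of_integral_ne_zero
  rw [heat_integral ht]; norm_num

lemma fourier_csmul (c : ℂ) (k : EuclideanSpace ℝ (Fin d) → ℂ) (ξ : EuclideanSpace ℝ (Fin d)) :
    𝓕 (c • k) ξ = c * 𝓕 k ξ := by
  simp only [Real.fourier_eq, Pi.smul_apply, Circle.smul_def, smul_eq_mul]
  rw [← integral_const_mul]
  congr 1; ext v; ring

lemma heat_fourier {t : ℝ} (ht : 0 < t) (ξ : EuclideanSpace ℝ (Fin d)) :
    𝓕 (fun x : EuclideanSpace ℝ (Fin d) => (heat t x : ℂ)) ξ = (rexp (-t * ‖ξ‖ ^ 2) : ℂ) := by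
  have hb : 0 < (((π ^ 2 / t : ℝ) : ℂ)).re := by
    rw [Complex.ofReal_re]; positivity
  have h := fourier_gaussian_innerProductSpace (V := EuclideanSpace ℝ (Fin d)) hb ξ
  have h1 : (fun x : EuclideanSpace ℝ (Fin d) => (heat t x : ℂ)) =
      (((π / t) ^ ((d : ℝ) / 2) : ℝ) : ℂ) • (fun v : EuclideanSpace ℝ (Fin d) =>
        Complex.exp (-((π ^ 2 / t : ℝ) : ℂ) * ‖v‖ ^ 2)) := by
    ext x
    simp [heat]
  rw [h1, fourier_csmul, h, finrank_euclideanSpace_fin]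
  have h2 : ((π : ℂ) / ((π ^ 2 / t : ℝ) : ℂ)) ^ ((d : ℂ) / 2) =
      (((t / π) ^ ((d : ℝ) / 2) : ℝ) : ℂ) := by
    rw [Complex.ofReal_cpow (by positivity)]
    congr 1
    · push_cast
      have : (π : ℂ) ≠ 0 := by exact_mod_cast Real.pi_ne_zero
      have : (t : ℂ) ≠ 0 := by exact_mod_cast ht.ne'
      field_simp
    · push_cast; rfl
  rw [h2, ← mul_assoc, ← Complex.ofReal_mul, ← Real.mul_rpow (by positivity) (by positivity)]
  have h3 : π / t * (t / π) = 1 := by field_simp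
  rw [h3, Real.one_rpow]
  push_cast
  rw [one_mul]
  congr 1
  have : (π : ℂ) ≠ 0 := by exact_mod_cast Real.pi_ne_zero
  have : (t : ℂ) ≠ 0 := by exact_mod_cast ht.ne'
  field_simp

lemma heat_measurable : Measurable
    (fun p : ℝ × EuclideanSpace ℝ (Fin d) => heat p.1 p.2) := by
  unfold heat
  fun_prop

/-- Real Fourier multiplier given by an integrable kernel of norm at most `B`. -/
def Mult (m : EuclideanSpace ℝ (Fin d) → ℝ) (B : ℝ) : Prop :=
  ∃ k : EuclideanSpace ℝ (Fin d) → ℂ, Integrable k ∧ ∫ x, ‖k x‖ ≤ B ∧ ∀ ξ, 𝓕 k ξ = (m ξ : ℂ)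

section mix

set_option linter.unusedSectionVars false

variable {Ω : Type*} [MeasurableSpace Ω] {μ : Measure Ω} [SFinite μ]

lemma mix_integrable {w τ : Ω → ℝ} (hw : Integrable w μ) (hτ : Measurable τ)
    (hpos : ∀ᵐ ω ∂μ, 0 < τ ω) :
    Integrable (fun p : Ω × EuclideanSpace ℝ (Fin d) =>
      w p.1 * heat (τ p.1) p.2) (μ.prod volume) := by
  have hmeas : AEStronglyMeasurable (fun p : Ω × EuclideanSpace ℝ (Fin d) =>
      w p.1 * heat (τ p.1) p.2) (μ.prod volume) := by
    apply AEStronglyMeasurable.mul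
    · exact hw.aestronglyMeasurable.comp_fst
    · apply Measurable.aestronglyMeasurable
      exact heat_measurable.comp (((hτ.comp measurable_fst)).prodMk measurable_snd)
  rw [integrable_prod_iff hmeas]
  constructor
  · filter_upwards [hpos] with ω h
    exact (heat_integrable h).const_mul _
  · apply hw.norm.mono' hmeas.norm.integral_prod_right'
    filter_upwards [hpos] with ω h
    have : ∀ x : EuclideanSpace ℝ (Fin d), ‖w ω * heat (τ ω) x‖
        = ‖w ω‖ * heat (τ ω) x := by
      intro x
      rw [norm_mul, Real.norm_of_nonneg (heat_nonneg h x)]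
    simp_rw [this]
    rw [integral_const_mul, heat_integral h, mul_one, Real.norm_of_nonneg (by positivity)]

/-- Mixture kernel. -/
noncomputable def mixK (μ : Measure Ω) (w τ : Ω → ℝ) (x : EuclideanSpace ℝ (Fin d)) : ℝ :=
  ∫ ω, w ω * heat (τ ω) x ∂μ

lemma mixK_integrable {w τ : Ω → ℝ} (hw : Integrable w μ) (hτ : Measurable τ)
    (hpos : ∀ᵐ ω ∂μ, 0 < τ ω) :
    Integrable (fun x : EuclideanSpace ℝ (Fin d) => mixK μ w τ x) :=
  (mix_integrable hw hτ hpos).integral_prod_right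

lemma mixK_norm {w τ : Ω → ℝ} (hw : Integrable w μ) (hτ : Measurable τ)
    (hpos : ∀ᵐ ω ∂μ, 0 < τ ω) :
    ∫ x : EuclideanSpace ℝ (Fin d), ‖mixK μ w τ x‖ ≤ ∫ ω, |w ω| ∂μ := by
  have hI := mix_integrable (d := d) hw hτ hpos
  calc ∫ x : EuclideanSpace ℝ (Fin d), ‖mixK μ w τ x‖
      ≤ ∫ x : EuclideanSpace ℝ (Fin d), ∫ ω, ‖w ω * heat (τ ω) x‖ ∂μ := by
        apply integral_mono
        · exact (mixK_integrable hw hτ hpos).norm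
        · exact hI.norm.integral_prod_right
        · intro x; exact norm_integral_le_integral_norm _
    _ = ∫ ω, (∫ x : EuclideanSpace ℝ (Fin d), ‖w ω * heat (τ ω) x‖) ∂μ := by
        rw [integral_integral_swap]
        exact hI.norm.swap
    _ ≤ _ := by
        apply integral_mono_ae
        · exact hI.norm.integral_prod_left
        · exact hw.norm
        filter_upwards [hpos] with ω h
        have : ∀ x : EuclideanSpace ℝ (Fin d), ‖w ω * heat (τ ω) x‖
            = ‖w ω‖ * heat (τ ω) x := by
          intro x
          rw [norm_mul, Real.norm_of_nonneg (heat_nonneg h x)]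
        simp_rw [this]
        rw [integral_const_mul, heat_integral h, mul_one]
        exact le_rfl

lemma mixK_fourier {w τ : Ω → ℝ} (hw : Integrable w μ) (hτ : Measurable τ)
    (hpos : ∀ᵐ ω ∂μ, 0 < τ ω) (ξ : EuclideanSpace ℝ (Fin d)) :
    𝓕 (fun x : EuclideanSpace ℝ (Fin d) => (mixK μ w τ x : ℂ)) ξ =
      ((∫ ω, w ω * rexp (-τ ω * ‖ξ‖ ^ 2) ∂μ : ℝ) : ℂ) := by
  have hI := mix_integrable (d := d) hw hτ hpos
  rw [Real.fourier_eq]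
  calc ∫ v : EuclideanSpace ℝ (Fin d), Real.fourierChar (-inner ℝ v ξ) • (mixK μ w τ v : ℂ)
      = ∫ v : EuclideanSpace ℝ (Fin d), ∫ ω, Real.fourierChar (-inner ℝ v ξ) •
          ((w ω * heat (τ ω) v : ℝ) : ℂ) ∂μ := by
        congr 1; ext v
        simp only [Circle.smul_def]
        rw [integral_smul, mixK, integral_complex_ofReal]
    _ = ∫ ω, (∫ v : EuclideanSpace ℝ (Fin d), Real.fourierChar (-inner ℝ v ξ) •
          ((w ω * heat (τ ω) v : ℝ) : ℂ)) ∂μ := by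
        apply integral_integral_swap
        have h2 := hI.swap.ofReal (𝕜 := ℂ)
        refine h2.mono ?_ ?_
        · have hc : Continuous (fun v : EuclideanSpace ℝ (Fin d) =>
              Real.fourierChar (-inner ℝ v ξ)) :=
            Real.continuous_fourierChar.comp (by fun_prop)
          exact (hc.aestronglyMeasurable.comp_fst).smul h2.aestronglyMeasurable
        · filter_upwards with ⟨x, y⟩ using by simp
    _ = ∫ ω, ((w ω * rexp (-τ ω * ‖ξ‖ ^ 2) : ℝ) : ℂ) ∂μ := by
        apply integral_congr_ae
        filter_upwards [hpos] with ω h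
        have := heat_fourier h ξ
        rw [Real.fourier_eq] at this
        calc _ = ∫ v : EuclideanSpace ℝ (Fin d), ((w ω : ℝ) : ℂ) *
              (Real.fourierChar (-inner ℝ v ξ) • (heat (τ ω) v : ℂ)) := by
              congr 1; ext v
              simp only [Circle.smul_def, smul_eq_mul]
              push_cast; ring
          _ = _ := by
              rw [integral_const_mul, this]
              norm_cast
    _ = _ := integral_complex_ofReal

lemma mult_mix {w τ : Ω → ℝ} (hw : Integrable w μ) (hτ : Measurable τ)
    (hpos : ∀ᵐ ω ∂μ, 0 < τ ω) :
    Mult (fun ξ : EuclideanSpace ℝ (Fin d) => ∫ ω, w ω * rexp (-τ ω * (1 + ‖ξ‖ ^ 2)) ∂μ)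
      (∫ ω, |w ω| ∂μ) := by
  have hw2 : Integrable (fun ω => w ω * rexp (-τ ω)) μ := by
    apply hw.norm.mono' (hw.aestronglyMeasurable.mul (by fun_prop))
    filter_upwards [hpos] with ω h
    rw [Pi.mul_apply, norm_mul]
    apply mul_le_of_le_one_right (norm_nonneg _)
    rw [Real.norm_of_nonneg (Real.exp_pos _).le, Real.exp_le_one_iff]
    linarith
  refine ⟨fun x => (mixK μ (fun ω => w ω * rexp (-τ ω)) τ x : ℂ),
    (mixK_integrable hw2 hτ hpos).ofReal, ?_, fun ξ => ?_⟩
  · have h1 := mixK_norm (d := d) hw2 hτ hpos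
    simp only [Complex.norm_real]
    refine h1.trans (integral_mono_ae hw2.norm hw.norm ?_)
    filter_upwards [hpos] with ω h
    change |w ω * rexp (-τ ω)| ≤ |w ω|
    rw [abs_mul]
    apply mul_le_of_le_one_right (abs_nonneg _)
    rw [abs_of_pos (Real.exp_pos _), Real.exp_le_one_iff]
    linarith
  · rw [mixK_fourier hw2 hτ hpos ξ]
    congr 2; ext ω
    rw [mul_assoc, ← Real.exp_add]
    congr 2; ring

end mix

lemma Mult.mul {m₁ m₂ : EuclideanSpace ℝ (Fin d) → ℝ} {B₁ B₂ : ℝ} (h₁ : Mult m₁ B₁)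
    (h₂ : Mult m₂ B₂) : Mult (fun ξ => m₁ ξ * m₂ ξ) (B₁ * B₂) := by
  obtain ⟨k₁, hi₁, hb₁, hf₁⟩ := h₁
  obtain ⟨k₂, hi₂, hb₂, hf₂⟩ := h₂
  refine ⟨MeasureTheory.convolution k₁ k₂ (ContinuousLinearMap.mul ℂ ℂ) volume,
    hi₁.integrable_convolution _ hi₂, ?_, ?_⟩
  · have hI := (hi₁.norm.convolution_integrand (ContinuousLinearMap.mul ℝ ℝ) hi₂.norm)
    calc _ ≤ ∫ x, MeasureTheory.convolution (fun y => ‖k₁ y‖) (fun y => ‖k₂ y‖)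
          (ContinuousLinearMap.mul ℝ ℝ) volume x := by
          apply integral_mono
          · exact (hi₁.integrable_convolution _ hi₂).norm
          · exact hi₁.norm.integrable_convolution _ hi₂.norm
          · intro x
            simp only [MeasureTheory.convolution, ContinuousLinearMap.mul_apply']
            refine (norm_integral_le_integral_norm _).trans (le_of_eq ?_)
            simp only [norm_mul]
      _ = (∫ x, ‖k₁ x‖) * (∫ x, ‖k₂ x‖) := by
          rw [integral_convolution _ hi₁.norm hi₂.norm]; rfl
      _ ≤ _ := by
          have : 0 ≤ ∫ x, ‖k₁ x‖ := integral_nonneg fun _ => norm_nonneg _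
          have : 0 ≤ ∫ x, ‖k₂ x‖ := integral_nonneg fun _ => norm_nonneg _
          gcongr
          linarith
  · intro ξ
    rw [Real.fourier_mul_convolution_eq hi₁ hi₂, hf₁, hf₂]
    push_cast; rfl

lemma Mult.const_mul {m : EuclideanSpace ℝ (Fin d) → ℝ} {B : ℝ} (h : Mult m B) (c : ℝ) :
    Mult (fun ξ => c * m ξ) (|c| * B) := by
  obtain ⟨k, hi, hb, hf⟩ := h
  refine ⟨(c : ℂ) • k, hi.smul _, ?_, ?_⟩
  · simp only [Pi.smul_apply, norm_smul]
    rw [integral_const_mul]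
    simp only [Complex.norm_real, Real.norm_eq_abs]
    gcongr
  · intro ξ
    rw [fourier_csmul, hf]
    push_cast; rfl

lemma Mult.sum {ι : Type*} (s : Finset ι) {m : ι → EuclideanSpace ℝ (Fin d) → ℝ} {B : ι → ℝ}
    (h : ∀ i ∈ s, Mult (m i) (B i)) : Mult (fun ξ => ∑ i ∈ s, m i ξ) (∑ i ∈ s, B i) := by
  classical
  induction s using Finset.induction_on with
  | empty =>
    refine ⟨fun _ => 0, integrable_zero _ _ _, by simp, fun ξ => by simp [Real.fourier_eq]⟩
  | insert a s ha ih =>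
    obtain ⟨k, hi, hb, hf⟩ := ih fun i hi => h i (Finset.mem_insert_of_mem hi)
    obtain ⟨k', hi', hb', hf'⟩ := h a (Finset.mem_insert_self _ _)
    refine ⟨k' + k, hi'.add hi, ?_, ?_⟩
    · rw [Finset.sum_insert ha]
      calc ∫ x, ‖(k' + k) x‖ ≤ ∫ x, (‖k' x‖ + ‖k x‖) := by
            apply integral_mono (hi'.add hi).norm (hi'.norm.add hi.norm)
            intro x; exact norm_add_le _ _
        _ ≤ _ := by rw [integral_add hi'.norm hi.norm]; gcongr
    · intro ξ
      have : 𝓕 (k' + k) ξ = 𝓕 k' ξ + 𝓕 k ξ := by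
        simp only [Real.fourier_eq, Pi.add_apply, smul_add]
        rw [integral_add] <;> simpa
      rw [this, hf, hf']
      simp only [Finset.sum_insert ha]
      push_cast; rfl

lemma Mult.pow {m : EuclideanSpace ℝ (Fin d) → ℝ} {B : ℝ} (h : Mult m B) (n : ℕ) :
    Mult (fun ξ => m ξ ^ (n + 1)) (B ^ (n + 1)) := by
  induction n with
  | zero => simpa using h
  | succ n ih => simpa [pow_succ] using ih.mul h

/-- Kernel representation of multipliers on Schwartz functions. -/
lemma kernel_rep {k₁ k₂ : EuclideanSpace ℝ (Fin d) → ℂ} (hk₁ : Integrable k₁) (hk₂ : Integrable k₂)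
    {m₁ m₂ : EuclideanSpace ℝ (Fin d) → ℝ} (hm₁ : ∀ ξ, 𝓕 k₁ ξ = (m₁ ξ : ℂ))
    (hm₂ : ∀ ξ, 𝓕 k₂ ξ = (m₂ ξ : ℂ))
    (h₁ h₂ v : SchwartzMap (EuclideanSpace ℝ (Fin d)) ℂ)
    (hv : ∀ ξ, 𝓕 (⇑v) ξ = (m₁ ξ : ℂ) * 𝓕 (⇑h₁) ξ + (m₂ ξ : ℂ) * 𝓕 (⇑h₂) ξ)
    (x : EuclideanSpace ℝ (Fin d)) :
    v x = (∫ y, k₁ y * h₁ (x - y)) + ∫ y, k₂ y * h₂ (x - y) := by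
  set w₁ := MeasureTheory.convolution k₁ (⇑h₁) (ContinuousLinearMap.mul ℂ ℂ) volume with hw₁
  set w₂ := MeasureTheory.convolution k₂ (⇑h₂) (ContinuousLinearMap.mul ℂ ℂ) volume with hw₂
  have hi₁ : Integrable w₁ := hk₁.integrable_convolution _ h₁.integrable
  have hi₂ : Integrable w₂ := hk₂.integrable_convolution _ h₂.integrable
  have h1 : 𝓕 (w₁ + w₂) = 𝓕 (⇑v) := by
    ext ξ
    have : 𝓕 (w₁ + w₂) ξ = 𝓕 w₁ ξ + 𝓕 w₂ ξ := by
      simp only [Real.fourier_eq, Pi.add_apply, smul_add]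
      rw [integral_add] <;> simpa
    rw [this, hw₁, hw₂, Real.fourier_mul_convolution_eq hk₁ h₁.integrable,
      Real.fourier_mul_convolution_eq hk₂ h₂.integrable, hv, hm₁, hm₂]
  have h2 : Integrable (𝓕 (⇑v)) := by
    rw [← SchwartzMap.fourier_coe]
    exact (𝓕 v).integrable
  have hc : ∀ (k : EuclideanSpace ℝ (Fin d) → ℂ) (_ : Integrable k)
      (h : SchwartzMap (EuclideanSpace ℝ (Fin d)) ℂ), Continuous
      (MeasureTheory.convolution k (⇑h) (ContinuousLinearMap.mul ℂ ℂ) volume) := by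
    intro k hk h
    apply BddAbove.continuous_convolution_right_of_integrable _ _ hk h.continuous
    refine ⟨‖h.toBoundedContinuousFunction‖, ?_⟩
    rintro _ ⟨y, rfl⟩
    exact h.toBoundedContinuousFunction.norm_coe_le_norm y
  have h3 : Continuous (w₁ + w₂) := (hc k₁ hk₁ h₁).add (hc k₂ hk₂ h₂)
  have h4 := h3.fourierInv_fourier_eq (hi₁.add hi₂) (h1 ▸ h2)
  have h5 := v.continuous.fourierInv_fourier_eq v.integrable h2
  rw [h1, h5] at h4
  rw [h4]
  rfl

end GNaux


namespace GNaux

variable {d : ℕ}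

lemma int_c {α : ℝ} (h0 : 0 < α) (h1 : α < 1) :
    IntegrableOn (fun s : ℝ => s ^ (-α - 1) * (1 - rexp (-s))) (Set.Ioi 0) := by
  have hm : Measurable (fun s : ℝ => s ^ (-α - 1) * (1 - rexp (-s))) := by fun_prop
  rw [← Set.Ioc_union_Ioi_eq_Ioi (zero_le_one : (0:ℝ) ≤ 1)]
  apply IntegrableOn.union
  · have : IntegrableOn (fun s : ℝ => s ^ (-α)) (Set.Ioc 0 1) :=
      (intervalIntegrable_iff_integrableOn_Ioc_of_le zero_le_one).1
        (intervalIntegral.intervalIntegrable_rpow' (by linarith))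
    apply Integrable.mono' this hm.aestronglyMeasurable
    filter_upwards [self_mem_ae_restrict measurableSet_Ioc] with s hs
    have hs0 := hs.1
    have he : rexp (-s) ≤ 1 := by rw [Real.exp_le_one_iff]; linarith
    have he2 : 1 - rexp (-s) ≤ s := by linarith [Real.add_one_le_exp (-s)]
    rw [Real.norm_of_nonneg (mul_nonneg (by positivity) (by linarith))]
    calc s ^ (-α - 1) * (1 - rexp (-s)) ≤ s ^ (-α - 1) * s := by gcongr
      _ = s ^ (-α) := by rw [Real.rpow_sub_one hs0.ne']; field_simp
  · have : IntegrableOn (fun s : ℝ => s ^ (-α - 1)) (Set.Ioi 1) :=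
      integrableOn_Ioi_rpow_of_lt (by linarith) one_pos
    apply Integrable.mono' this hm.aestronglyMeasurable
    filter_upwards [self_mem_ae_restrict measurableSet_Ioi] with s hs
    have hs0 : 0 < s := lt_trans one_pos hs
    have he : rexp (-s) ≤ 1 := by rw [Real.exp_le_one_iff]; linarith
    rw [Real.norm_of_nonneg (mul_nonneg (by positivity) (by linarith))]
    apply mul_le_of_le_one_right (by positivity)
    linarith [Real.exp_pos (-s)]

/-- Normalizing constant. -/
noncomputable def cc (α : ℝ) : ℝ := ∫ s in Set.Ioi (0:ℝ), s ^ (-α - 1) * (1 - rexp (-s))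

lemma cc_pos {α : ℝ} (h0 : 0 < α) (h1 : α < 1) : 0 < cc α := by
  unfold cc
  rw [setIntegral_pos_iff_support_of_nonneg_ae _ (int_c h0 h1)]
  · have : Function.support (fun s : ℝ => s ^ (-α - 1) * (1 - rexp (-s))) ∩ Set.Ioi 0 = Set.Ioi 0 := by
      apply Set.inter_eq_right.2
      intro s hs
      have hs : 0 < s := hs
      have : rexp (-s) < 1 := by rw [Real.exp_lt_one_iff]; linarith
      exact (mul_pos (by positivity) (by linarith)).ne'
    rw [this]; simp
  · filter_upwards [self_mem_ae_restrict measurableSet_Ioi] with s hs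
    have hs : 0 < s := hs
    have : rexp (-s) < 1 := by rw [Real.exp_lt_one_iff]; linarith
    exact (mul_pos (by positivity) (by linarith)).le

lemma cc_scale {α x : ℝ} (hx : 0 < x) :
    ∫ s in Set.Ioi (0:ℝ), s ^ (-α - 1) * (1 - rexp (-(s * x))) = cc α * x ^ α := by
  have h := integral_comp_mul_left_Ioi (fun s : ℝ => s ^ (-α - 1) * (1 - rexp (-s))) 0 hx
  rw [mul_zero, smul_eq_mul] at h
  have h2 : ∫ s in Set.Ioi (0:ℝ), (x * s) ^ (-α - 1) * (1 - rexp (-(x * s))) =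
      x ^ (-α - 1) * ∫ s in Set.Ioi (0:ℝ), s ^ (-α - 1) * (1 - rexp (-(s * x))) := by
    rw [← integral_const_mul]
    apply setIntegral_congr_fun measurableSet_Ioi
    intro s hs
    have hs : 0 < s := hs
    simp only
    rw [Real.mul_rpow hx.le hs.le, mul_comm x s]; ring
  rw [h2] at h
  have h3 : x ^ (-α - 1) * (x ^ α * x) = 1 := by
    rw [← Real.rpow_add_one hx.ne', ← Real.rpow_add hx]
    have : -α - 1 + (α + 1) = 0 := by ring
    rw [this, Real.rpow_zero]
  calc _ = (x ^ α * x) * (x ^ (-α - 1) * ∫ s in Set.Ioi (0:ℝ), s ^ (-α - 1) * (1 - rexp (-(s * x)))) := by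
        linear_combination (-∫ s in Set.Ioi (0:ℝ), s ^ (-α - 1) * (1 - rexp (-(s * x)))) * h3
    _ = _ := by rw [h, cc]; field_simp

/-- The weight on the quadrant. -/
noncomputable def ww (α : ℝ) (p : ℝ × ℝ) : ℝ :=
  p.1 ^ (-α - 1) * (rexp (-p.2) - if p.1 < p.2 then rexp (p.1 - p.2) else 0)

lemma ww_meas (α : ℝ) : Measurable (ww α) := by
  unfold ww
  apply Measurable.mul (by fun_prop)
  apply Measurable.sub (by fun_prop)
  apply Measurable.ite
  · exact measurableSet_lt measurable_fst measurable_snd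
  · fun_prop
  · fun_prop

lemma int_exp {a : ℝ} (ha : 0 < a) (s : ℝ) :
    IntegrableOn (fun t => rexp (-(a * t))) (Set.Ioi s) := by
  simpa [neg_mul] using integrableOn_exp_mul_Ioi (a := -a) (by linarith) s

lemma val_exp {a : ℝ} (ha : 0 < a) (s : ℝ) :
    ∫ t in Set.Ioi s, rexp (-(a * t)) = rexp (-(a * s)) / a := by
  have := integral_exp_mul_Ioi (a := -a) (by linarith) s
  simp only [neg_mul] at this
  rw [this]; field_simp

lemma restr {s : ℝ} (hs : 0 < s) (f : ℝ → ℝ) :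
    ∫ t in Set.Ioi (0:ℝ), (if s < t then f t else 0) = ∫ t in Set.Ioi s, f t := by
  have : (fun t => if s < t then f t else 0) = (Set.Ioi s).indicator f := by
    ext t; simp [Set.indicator]
  rw [this, setIntegral_indicator measurableSet_Ioi]
  congr 2
  apply Set.inter_eq_right.2
  intro t ht
  exact lt_trans hs ht

lemma restr_int {s : ℝ} {f : ℝ → ℝ} (hf : IntegrableOn f (Set.Ioi s)) :
    IntegrableOn (fun t => if s < t then f t else 0) (Set.Ioi 0) := by
  have : (fun t => if s < t then f t else 0) = (Set.Ioi s).indicator f := by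
    ext t; simp [Set.indicator]
  rw [this]
  exact (hf.integrable_indicator measurableSet_Ioi).integrableOn

/-- The reference measure on the quadrant. -/
noncomputable def mu2 : Measure (ℝ × ℝ) :=
  (volume.restrict (Set.Ioi 0)).prod (volume.restrict (Set.Ioi 0))

instance : SFinite mu2 := by unfold mu2; infer_instance

lemma ww_abs {α s t : ℝ} (hs : 0 < s) : ‖ww α (s, t)‖ =
    s ^ (-α - 1) * (rexp (-(1 * t)) + if s < t then (rexp s - 2) * rexp (-(1 * t)) else 0) := by
  unfold ww
  rw [norm_mul, Real.norm_of_nonneg (by positivity)]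
  congr 1
  have h1 : 1 < rexp s := by rw [Real.one_lt_exp_iff]; exact hs
  rw [one_mul]
  split_ifs with h
  · rw [sub_eq_add_neg s t, Real.exp_add, Real.norm_of_nonpos]
    · ring
    · nlinarith [Real.exp_pos (-t)]
  · simp

lemma ww_int {α : ℝ} (h0 : 0 < α) (h1 : α < 1) : Integrable (ww α) mu2 := by
  unfold mu2
  rw [integrable_prod_iff (ww_meas α).aestronglyMeasurable]
  have hA : ∀ s, IntegrableOn (fun t => if s < t then (rexp s - 2) * rexp (-(1 * t)) else 0) (Set.Ioi 0) :=
    fun s => restr_int ((int_exp one_pos s).const_mul _)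
  constructor
  · filter_upwards [self_mem_ae_restrict measurableSet_Ioi] with s hs
    have hs : 0 < s := hs
    have hm : AEStronglyMeasurable (fun y => ww α (s, y)) (volume.restrict (Set.Ioi 0)) :=
      ((ww_meas α).comp measurable_prodMk_left).aestronglyMeasurable
    rw [← integrable_norm_iff hm]
    simp_rw [ww_abs hs]
    exact ((int_exp one_pos 0).add (hA s)).const_mul _
  · apply ((int_c h0 h1).const_mul 2).congr
    filter_upwards [self_mem_ae_restrict measurableSet_Ioi] with s hs
    have hs : 0 < s := hs
    simp_rw [ww_abs hs]
    rw [integral_const_mul, integral_add (int_exp one_pos 0) (hA s), restr hs, integral_const_mul,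
      val_exp one_pos, val_exp one_pos]
    simp only [mul_zero, neg_zero, Real.exp_zero, one_mul, div_one]
    have : rexp s * rexp (-s) = 1 := by rw [← Real.exp_add]; simp
    linear_combination (-s ^ (-α - 1)) * this

lemma ww_val {α x : ℝ} (h0 : 0 < α) (h1 : α < 1) (hx : 0 < x) :
    ∫ p, ww α p * rexp (-(p.2 * x)) ∂mu2 = cc α * (x ^ α / (1 + x)) := by
  have hI : Integrable (fun p : ℝ × ℝ => ww α p * rexp (-(p.2 * x))) mu2 := by
    apply (ww_int h0 h1).norm.mono' ((ww_meas α).mul (by fun_prop)).aestronglyMeasurable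
    have : ∀ᵐ p ∂mu2, 0 < p.2 := by
      unfold mu2
      rw [Measure.prod_restrict]
      filter_upwards [self_mem_ae_restrict (measurableSet_Ioi.prod measurableSet_Ioi)] with p hp
      exact hp.2
    filter_upwards [this] with p hp
    rw [Pi.mul_apply, norm_mul]
    apply mul_le_of_le_one_right (norm_nonneg _)
    rw [Real.norm_of_nonneg (Real.exp_pos _).le, Real.exp_le_one_iff]
    have : 0 < p.2 * x := by positivity
    linarith
  unfold mu2 at hI ⊢
  rw [integral_prod _ hI]
  have hx1 : 0 < 1 + x := by linarith
  calc _ = ∫ s in Set.Ioi (0:ℝ), (s ^ (-α - 1) * (1 - rexp (-(s * x)))) * (1 + x)⁻¹ := by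
        apply setIntegral_congr_fun measurableSet_Ioi
        intro s hs
        have hs : 0 < s := hs
        have e1 : ∀ t, ww α (s, t) * rexp (-(t * x)) = s ^ (-α - 1) *
            (rexp (-((1 + x) * t)) - if s < t then rexp s * rexp (-((1 + x) * t)) else 0) := by
          intro t
          unfold ww
          have e2 : rexp (-((1 + x) * t)) = rexp (-t) * rexp (-(t * x)) := by
            rw [← Real.exp_add]; congr 1; ring
          simp only
          rw [e2]
          split_ifs
          · rw [sub_eq_add_neg s t, Real.exp_add]; ring
          · ring
        simp only
        simp_rw [e1]
        rw [integral_const_mul, integral_sub (int_exp hx1 0) (restr_int ((int_exp hx1 s).const_mul _)),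
          restr hs, integral_const_mul, val_exp hx1, val_exp hx1]
        have e3 : rexp s * rexp (-((1 + x) * s)) = rexp (-(s * x)) := by
          rw [← Real.exp_add]; congr 1; ring
        rw [mul_zero, neg_zero, Real.exp_zero, mul_div_assoc', e3]
        field_simp
    _ = _ := by
        rw [integral_mul_const, cc_scale hx]; field_simp

/-- Basic multipliers, uniformly in the scale. -/
lemma mult_basic {α : ℝ} (h0 : 0 < α) (h1 : α < 1) : ∃ B : ℝ, ∀ T : ℝ, 0 < T →
    Mult (fun ξ : EuclideanSpace ℝ (Fin d) =>
      (T * (1 + ‖ξ‖ ^ 2)) ^ α / (1 + T * (1 + ‖ξ‖ ^ 2))) B := by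
  refine ⟨|(cc α)⁻¹| * ∫ p, |ww α p| ∂mu2, fun T hT => ?_⟩
  have hpos : ∀ᵐ p ∂mu2, 0 < T * p.2 := by
    unfold mu2
    rw [Measure.prod_restrict]
    filter_upwards [self_mem_ae_restrict (measurableSet_Ioi.prod measurableSet_Ioi)] with p hp
    exact mul_pos hT hp.2
  have := (mult_mix (d := d) (ww_int h0 h1) (τ := fun p => T * p.2) (by fun_prop) hpos).const_mul (cc α)⁻¹
  convert this using 2 with ξ
  have hx : 0 < T * (1 + ‖ξ‖ ^ 2) := by positivity
  have h2 := ww_val h0 h1 hx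
  have h3 : ∀ p : ℝ × ℝ, -(T * p.2) * (1 + ‖ξ‖ ^ 2) = -(p.2 * (T * (1 + ‖ξ‖ ^ 2))) := by intro p; ring
  simp_rw [h3]
  rw [h2, ← mul_assoc, inv_mul_cancel₀ (cc_pos h0 h1).ne', one_mul]

/-- Higher order multipliers, uniformly in the scale. -/
lemma mult_high {e : ℝ} {n : ℕ} (h0 : 0 < e) (h1 : e < n) : ∃ B : ℝ, ∀ T : ℝ, 0 < T →
    Mult (fun ξ : EuclideanSpace ℝ (Fin d) =>
      (T * (1 + ‖ξ‖ ^ 2)) ^ e / (1 + T * (1 + ‖ξ‖ ^ 2)) ^ n) B := by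
  have hn : (0:ℝ) < n := h0.trans h1
  obtain ⟨m, rfl⟩ : ∃ m, n = m + 1 := ⟨n - 1, by have : 0 < n := by exact_mod_cast hn
                                                 omega⟩
  obtain ⟨B, hB⟩ := mult_basic (d := d) (α := e / (m + 1 : ℕ)) (by positivity) ((div_lt_one hn).2 h1)
  refine ⟨B ^ (m + 1), fun T hT => ?_⟩
  convert (hB T hT).pow m using 2 with ξ
  have hx : 0 < T * (1 + ‖ξ‖ ^ 2) := by positivity
  rw [div_pow, ← Real.rpow_mul_natCast hx.le]
  congr 2
  field_simp

end GNaux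


namespace GNaux

variable {d : ℕ}

lemma Mult.mono {m : EuclideanSpace ℝ (Fin d) → ℝ} {B B' : ℝ} (h : Mult m B) (hB : B ≤ B') :
    Mult m B' := by
  obtain ⟨k, h1, h2, h3⟩ := h
  exact ⟨k, h1, h2.trans hB, h3⟩

lemma Mult.zero : Mult (fun _ : EuclideanSpace ℝ (Fin d) => (0 : ℝ)) 0 := by
  refine ⟨fun _ => 0, integrable_zero _ _ _, by simp, fun ξ => ?_⟩
  simp [Real.fourier_eq]

lemma term_split {b β : ℝ} (hb : 0 < b) (hβ : 0 < β) {n i : ℕ} (hn : b + β < n) (hi : i ≤ n) :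
    ∃ A B : ℝ, ∀ T : ℝ, 0 < T → ∃ m₁ m₂ : EuclideanSpace ℝ (Fin d) → ℝ,
      Mult m₁ (A * T ^ (-β)) ∧ Mult m₂ (B * T ^ b) ∧
      ∀ ξ : EuclideanSpace ℝ (Fin d),
        (T * (1 + ‖ξ‖ ^ 2)) ^ (n - i) * (n.choose i) / (1 + T * (1 + ‖ξ‖ ^ 2)) ^ n =
        m₁ ξ * (1 + ‖ξ‖ ^ 2) ^ (-β) + m₂ ξ * (1 + ‖ξ‖ ^ 2) ^ b := by
  have hni : ((n - i : ℕ) : ℝ) = n - i := by push_cast [hi]; ring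
  have hi' : (i : ℝ) ≤ n := by exact_mod_cast hi
  by_cases h : β < i
  · obtain ⟨A, hA⟩ := mult_high (d := d) (e := β + (n - i)) (n := n) (by linarith) (by linarith)
    refine ⟨n.choose i * A, 0, fun T hT => ?_⟩
    refine ⟨_, _, ((hA T hT).const_mul (T ^ (-β) * n.choose i)).mono (le_of_eq ?_),
      Mult.zero.mono (by simp), fun ξ => ?_⟩
    · rw [abs_of_nonneg (by positivity)]; ring
    · have hL : 0 < 1 + ‖ξ‖ ^ 2 := by positivity
      rw [Real.rpow_add (by positivity), ← hni, Real.rpow_natCast, Real.mul_rpow hT.le hL.le,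
        Real.rpow_neg hT.le, Real.rpow_neg hL.le]
      have := Real.rpow_pos_of_pos hT β
      have := Real.rpow_pos_of_pos hL β
      field_simp
      ring
  · obtain ⟨A, hA⟩ := mult_high (d := d) (e := (n - i) - b) (n := n) (by linarith)
      (by linarith [Nat.cast_nonneg (α := ℝ) i])
    refine ⟨0, n.choose i * A, fun T hT => ?_⟩
    refine ⟨_, _, Mult.zero.mono (by simp),
      ((hA T hT).const_mul (T ^ b * n.choose i)).mono (le_of_eq ?_), fun ξ => ?_⟩
    · rw [abs_of_nonneg (by positivity)]; ring
    · have hL : 0 < 1 + ‖ξ‖ ^ 2 := by positivity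
      rw [Real.rpow_sub (by positivity), ← hni, Real.rpow_natCast, Real.mul_rpow hT.le hL.le]
      have := Real.rpow_pos_of_pos hT b
      have := Real.rpow_pos_of_pos hL b
      field_simp
      ring

lemma full_split {b β : ℝ} (hb : 0 < b) (hβ : 0 < β) :
    ∃ A B : ℝ, 0 < A ∧ 0 < B ∧ ∀ T : ℝ, 0 < T → ∃ m₁ m₂ : EuclideanSpace ℝ (Fin d) → ℝ,
      Mult m₁ (A * T ^ (-β)) ∧ Mult m₂ (B * T ^ b) ∧
      ∀ ξ : EuclideanSpace ℝ (Fin d),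
        1 = m₁ ξ * (1 + ‖ξ‖ ^ 2) ^ (-β) + m₂ ξ * (1 + ‖ξ‖ ^ 2) ^ b := by
  obtain ⟨n, hn⟩ := exists_nat_gt (b + β)
  have key : ∀ i : ℕ, ∃ A B : ℝ, i ≤ n → ∀ T : ℝ, 0 < T →
      ∃ m₁ m₂ : EuclideanSpace ℝ (Fin d) → ℝ,
      Mult m₁ (A * T ^ (-β)) ∧ Mult m₂ (B * T ^ b) ∧
      ∀ ξ : EuclideanSpace ℝ (Fin d),
        (T * (1 + ‖ξ‖ ^ 2)) ^ (n - i) * (n.choose i) / (1 + T * (1 + ‖ξ‖ ^ 2)) ^ n =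
        m₁ ξ * (1 + ‖ξ‖ ^ 2) ^ (-β) + m₂ ξ * (1 + ‖ξ‖ ^ 2) ^ b := by
    intro i
    by_cases hi : i ≤ n
    · obtain ⟨A, B, h⟩ := term_split (d := d) hb hβ hn hi
      exact ⟨A, B, fun _ => h⟩
    · exact ⟨0, 0, fun h => absurd h hi⟩
  choose A B hAB using key
  refine ⟨∑ i ∈ Finset.range (n + 1), |A i| + 1, ∑ i ∈ Finset.range (n + 1), |B i| + 1,
    by positivity, by positivity, fun T hT => ?_⟩
  have hx : ∀ i : ℕ, ∃ m₁ m₂ : EuclideanSpace ℝ (Fin d) → ℝ, i ≤ n →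
      Mult m₁ (A i * T ^ (-β)) ∧ Mult m₂ (B i * T ^ b) ∧
      ∀ ξ : EuclideanSpace ℝ (Fin d),
        (T * (1 + ‖ξ‖ ^ 2)) ^ (n - i) * (n.choose i) / (1 + T * (1 + ‖ξ‖ ^ 2)) ^ n =
        m₁ ξ * (1 + ‖ξ‖ ^ 2) ^ (-β) + m₂ ξ * (1 + ‖ξ‖ ^ 2) ^ b := by
    intro i
    by_cases hi : i ≤ n
    · obtain ⟨m₁, m₂, h⟩ := hAB i hi T hT
      exact ⟨m₁, m₂, fun _ => h⟩
    · exact ⟨0, 0, fun h => absurd h hi⟩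
  choose m₁ m₂ hm using hx
  have hle : ∀ i ∈ Finset.range (n + 1), i ≤ n := fun i hi => by
    have := Finset.mem_range.1 hi; omega
  refine ⟨fun ξ => ∑ i ∈ Finset.range (n + 1), m₁ i ξ, fun ξ => ∑ i ∈ Finset.range (n + 1), m₂ i ξ,
    (Mult.sum _ (fun i hi => (hm i (hle i hi)).1)).mono ?_,
    (Mult.sum _ (fun i hi => (hm i (hle i hi)).2.1)).mono ?_, fun ξ => ?_⟩
  · rw [← Finset.sum_mul]
    apply mul_le_mul_of_nonneg_right _ (by positivity)
    have := Finset.sum_le_sum (fun i (_ : i ∈ Finset.range (n + 1)) => le_abs_self (A i))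
    linarith
  · rw [← Finset.sum_mul]
    apply mul_le_mul_of_nonneg_right _ (by positivity)
    have := Finset.sum_le_sum (fun i (_ : i ∈ Finset.range (n + 1)) => le_abs_self (B i))
    linarith
  · rw [Finset.sum_mul, Finset.sum_mul, ← Finset.sum_add_distrib,
      ← Finset.sum_congr rfl (fun i hi => (hm i (hle i hi)).2.2 ξ), ← Finset.sum_div]
    have : (1 + T * (1 + ‖ξ‖ ^ 2)) ^ n = ∑ i ∈ Finset.range (n + 1),
        (T * (1 + ‖ξ‖ ^ 2)) ^ (n - i) * (n.choose i) := by
      rw [add_pow]; simp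
    rw [← this, div_self]
    positivity

/-- Pointwise decomposition used for the level set argument. -/
def Dec (u g : EuclideanSpace ℝ (Fin d) → ℂ) (b β A B M : ℝ) : Prop :=
  ∀ T : ℝ, 0 < T → ∃ k : EuclideanSpace ℝ (Fin d) → ℝ≥0∞, Measurable k ∧
      ∫⁻ y, k y ≤ ENNReal.ofReal (B * T ^ b) ∧
      ∀ x, ‖u x‖ₑ ≤ ENNReal.ofReal (A * T ^ (-β) * M) + ∫⁻ y, k y * ‖g (x - y)‖ₑ

lemma near_kernel {k : EuclideanSpace ℝ (Fin d) → ℂ} (hk : Integrable k) {B : ℝ}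
    (hB : ∫ y, ‖k y‖ ≤ B) : ∃ k' : EuclideanSpace ℝ (Fin d) → ℝ≥0∞, Measurable k' ∧
      ∫⁻ y, k' y ≤ ENNReal.ofReal B ∧ ∀ (g : EuclideanSpace ℝ (Fin d) → ℂ) x,
      ‖∫ y, k y * g (x - y)‖ₑ ≤ ∫⁻ y, k' y * ‖g (x - y)‖ₑ := by
  refine ⟨fun y => ‖hk.aestronglyMeasurable.mk k y‖ₑ,
    hk.aestronglyMeasurable.stronglyMeasurable_mk.measurable.enorm, ?_, fun g x => ?_⟩
  · calc _ = ∫⁻ y, ‖k y‖ₑ := by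
          apply lintegral_congr_ae
          filter_upwards [hk.aestronglyMeasurable.ae_eq_mk] with y hy
          rw [← hy]
      _ = ENNReal.ofReal (∫ y, ‖k y‖) := by
          rw [ofReal_integral_norm_eq_lintegral_enorm hk]
      _ ≤ _ := ENNReal.ofReal_le_ofReal hB
  · refine (enorm_integral_le_lintegral_enorm _).trans (le_of_eq ?_)
    apply lintegral_congr_ae
    filter_upwards [hk.aestronglyMeasurable.ae_eq_mk] with y hy
    rw [enorm_mul, ← hy]

lemma decF {b β : ℝ} (hb : 0 < b) (hβ : 0 < β) :
    ∃ A B : ℝ, 0 < A ∧ 0 < B ∧ ∀ u f g : SchwartzMap (EuclideanSpace ℝ (Fin d)) ℂ,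
      (∀ ξ, 𝓕 (⇑f) ξ = (((1 + ‖ξ‖ ^ 2) ^ (-β) : ℝ) : ℂ) * 𝓕 (⇑u) ξ) →
      (∀ ξ, 𝓕 (⇑g) ξ = (((1 + ‖ξ‖ ^ 2) ^ b : ℝ) : ℂ) * 𝓕 (⇑u) ξ) →
      ∀ M : ℝ, (∀ x, ‖f x‖ ≤ M) → Dec u g b β A B M := by
  obtain ⟨A, B, hA, hB, H⟩ := full_split (d := d) hb hβ
  refine ⟨A, B, hA, hB, fun u f g hf hg M hM T hT => ?_⟩
  obtain ⟨m₁, m₂, ⟨k₁, hk₁, hb₁, hf₁⟩, ⟨k₂, hk₂, hb₂, hf₂⟩, hm⟩ := H T hT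
  obtain ⟨k, hkm, hkb, hk⟩ := near_kernel hk₂ hb₂
  refine ⟨k, hkm, hkb, fun x => ?_⟩
  have hrep := kernel_rep hk₁ hk₂ hf₁ hf₂ f g u (fun ξ => by
    rw [hf, hg]
    have := hm ξ
    calc 𝓕 (⇑u) ξ = ((1 : ℝ) : ℂ) * 𝓕 (⇑u) ξ := by simp
      _ = ((m₁ ξ * (1 + ‖ξ‖ ^ 2) ^ (-β) + m₂ ξ * (1 + ‖ξ‖ ^ 2) ^ b : ℝ) : ℂ) * 𝓕 (⇑u) ξ := by
          rw [← this]
      _ = _ := by rw [Complex.ofReal_add, Complex.ofReal_mul, Complex.ofReal_mul]; ring) x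
  rw [hrep]
  refine (enorm_add_le _ _).trans (add_le_add ?_ (hk _ x))
  rw [← ofReal_norm]
  apply ENNReal.ofReal_le_ofReal
  have hM0 : 0 ≤ M := (norm_nonneg _).trans (hM 0)
  calc _ ≤ ∫ y, ‖k₁ y‖ * M := by
        apply norm_integral_le_of_norm_le (hk₁.norm.mul_const _)
        filter_upwards with y
        rw [norm_mul]
        exact mul_le_mul_of_nonneg_left (hM _) (norm_nonneg _)
    _ ≤ _ := by
        rw [integral_mul_const]
        exact mul_le_mul_of_nonneg_right hb₁ hM0

end GNaux


namespace GNaux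

variable {d : ℕ}

lemma heat_holder {t r : ℝ} (ht : 0 < t) (hr : 1 < r) {G : EuclideanSpace ℝ (Fin d) → ℝ≥0∞}
    (hG : Measurable G) :
    ∫⁻ y, ENNReal.ofReal (heat t y) * G y ≤
      ENNReal.ofReal ((π / t) ^ ((d : ℝ) / (2 * r))) * (∫⁻ y, G y ^ r) ^ (1 / r) := by
  have hpq : (Real.conjExponent r).HolderConjugate r := (Real.HolderConjugate.conjExponent hr).symm
  set p := Real.conjExponent r with hp
  have hp0 : 0 < p := hpq.pos
  have hp1 : 1 < p := hpq.lt
  have hpm : Measurable (fun y : EuclideanSpace ℝ (Fin d) => heat t y) :=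
    heat_measurable.comp (measurable_const.prodMk measurable_id)
  have hm : Measurable (fun y : EuclideanSpace ℝ (Fin d) => ENNReal.ofReal (heat t y)) :=
    hpm.ennreal_ofReal
  refine (ENNReal.lintegral_mul_le_Lp_mul_Lq volume hpq hm.aemeasurable hG.aemeasurable).trans ?_
  gcongr
  set C : ℝ := (π / t) ^ ((d : ℝ) / 2) with hC
  have hC0 : 0 < C := by positivity
  have h1 : ∫⁻ y : EuclideanSpace ℝ (Fin d), ENNReal.ofReal (heat t y) ^ p ≤
      ENNReal.ofReal (C ^ (p - 1)) := by
    calc _ ≤ ∫⁻ y : EuclideanSpace ℝ (Fin d),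
          ENNReal.ofReal (C ^ (p - 1)) * ENNReal.ofReal (heat t y) := by
          apply lintegral_mono
          intro y
          have h0 := heat_nonneg ht y
          simp only
          rw [ENNReal.ofReal_rpow_of_nonneg h0 hp0.le, ← ENNReal.ofReal_mul (by positivity)]
          apply ENNReal.ofReal_le_ofReal
          calc heat t y ^ p = heat t y ^ (p - 1) * heat t y := by
                rw [← Real.rpow_add_one' h0 (by simpa using hp0.ne')]; simp
            _ ≤ _ := by
                gcongr
                exact heat_le ht y
      _ = _ := by
          rw [lintegral_const_mul _ hm, ← ofReal_integral_eq_lintegral_ofReal (heat_integrable ht)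
            (Filter.Eventually.of_forall (heat_nonneg ht)), heat_integral ht]
          simp
  calc _ ≤ ENNReal.ofReal (C ^ (p - 1)) ^ (1 / p) := by gcongr
    _ = _ := by
      rw [ENNReal.ofReal_rpow_of_nonneg (by positivity) (by positivity), hC,
        ← Real.rpow_mul (by positivity), ← Real.rpow_mul (by positivity)]
      congr 2
      have : (p - 1) * (1 / p) = 1 / r := by
        have := hpq.inv_add_inv_eq_one
        field_simp at this ⊢
        nlinarith
      rw [this]
      have : 0 < r := by linarith
      field_simp

/-- weight for the Bessel kernel -/
noncomputable def bw (b t : ℝ) : ℝ := (Real.Gamma b)⁻¹ * (t ^ (b - 1) * rexp (-t))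

lemma bw_nonneg {b t : ℝ} (hb : 0 < b) (ht : 0 < t) : 0 ≤ bw b t := by
  have := Real.Gamma_pos_of_pos hb
  unfold bw; positivity

lemma bw_le {b t : ℝ} (hb : 0 < b) (ht : 0 < t) : bw b t ≤ (Real.Gamma b)⁻¹ * t ^ (b - 1) := by
  have := Real.Gamma_pos_of_pos hb
  unfold bw
  gcongr
  apply mul_le_of_le_one_right (by positivity)
  rw [Real.exp_le_one_iff]; linarith

lemma bw_integrable {b : ℝ} (hb : 0 < b) : IntegrableOn (bw b) (Set.Ioi 0) := by
  unfold bw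
  apply Integrable.const_mul
  have := Real.GammaIntegral_convergent hb
  refine this.congr_fun (fun t _ => ?_) measurableSet_Ioi
  ring

lemma bw_val {b s : ℝ} (hb : 0 < b) (hs : 0 ≤ s) :
    ∫ t in Set.Ioi 0, bw b t * rexp (-t * s) = (1 + s) ^ (-b) := by
  have h := Real.integral_rpow_mul_exp_neg_mul_Ioi hb (r := 1 + s) (by linarith)
  have hG := Real.Gamma_pos_of_pos hb
  calc _ = ∫ t in Set.Ioi 0, (Real.Gamma b)⁻¹ * (t ^ (b - 1) * rexp (-((1 + s) * t))) := by
        congr 1; ext t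
        unfold bw
        rw [mul_assoc, mul_assoc, ← Real.exp_add]
        congr 4; ring
    _ = _ := by
        rw [integral_const_mul, h, Real.rpow_neg (by linarith), one_div, Real.inv_rpow (by linarith)]
        field_simp

lemma bw_int_exp {b s : ℝ} (hb : 0 < b) (hs : 0 ≤ s) :
    IntegrableOn (fun t => bw b t * rexp (-t * s)) (Set.Ioi 0) := by
  apply (bw_integrable hb).norm.mono'
  · exact (bw_integrable hb).aestronglyMeasurable.mul (by fun_prop)
  · rw [ae_restrict_iff' measurableSet_Ioi]
    filter_upwards with t ht
    rw [norm_mul]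
    apply mul_le_of_le_one_right (norm_nonneg _)
    rw [Real.norm_of_nonneg (Real.exp_pos _).le, Real.exp_le_one_iff]
    have : 0 < t := ht
    nlinarith

lemma bw_near {b T : ℝ} (hb : 0 < b) (hT : 0 < T) :
    ∫ t in Set.Ioc 0 T, |bw b t| ≤ (Real.Gamma b)⁻¹ * b⁻¹ * T ^ b := by
  have hG := Real.Gamma_pos_of_pos hb
  have h1 : IntegrableOn (fun t : ℝ => (Real.Gamma b)⁻¹ * t ^ (b - 1)) (Set.Ioc 0 T) := by
    apply Integrable.const_mul
    exact (intervalIntegrable_iff_integrableOn_Ioc_of_le hT.le).1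
      (intervalIntegral.intervalIntegrable_rpow' (by linarith))
  calc _ ≤ ∫ t in Set.Ioc 0 T, (Real.Gamma b)⁻¹ * t ^ (b - 1) := by
        apply setIntegral_mono_on _ h1 measurableSet_Ioc
        · intro t ht
          rw [abs_of_nonneg (bw_nonneg hb ht.1)]
          exact bw_le hb ht.1
        · exact ((bw_integrable hb).mono_set Set.Ioc_subset_Ioi_self).norm
    _ = _ := by
        rw [integral_const_mul, ← intervalIntegral.integral_of_le hT.le,
          integral_rpow (Or.inl (by linarith))]
        rw [show b - 1 + 1 = b by ring, Real.zero_rpow hb.ne']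
        field_simp
        ring

lemma bw_far {b β s T : ℝ} (hb : 0 < b) (hβ : 0 < β) (hs : b + β = s) (hT : 0 < T) :
    ∫⁻ t in Set.Ioi T, ENNReal.ofReal (bw b t) * ENNReal.ofReal ((π / t) ^ s) ≤
      ENNReal.ofReal ((Real.Gamma b)⁻¹ * π ^ s * β⁻¹ * T ^ (-β)) := by
  have hG := Real.Gamma_pos_of_pos hb
  have hI : IntegrableOn (fun t : ℝ => (Real.Gamma b)⁻¹ * π ^ s * t ^ (-β - 1)) (Set.Ioi T) := by
    apply Integrable.const_mul
    exact integrableOn_Ioi_rpow_of_lt (by linarith) hT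
  calc _ ≤ ∫⁻ t in Set.Ioi T, ENNReal.ofReal ((Real.Gamma b)⁻¹ * π ^ s * t ^ (-β - 1)) := by
        apply setLIntegral_mono' measurableSet_Ioi
        intro t ht
        have ht0 : 0 < t := hT.trans ht
        rw [← ENNReal.ofReal_mul (bw_nonneg hb ht0)]
        apply ENNReal.ofReal_le_ofReal
        calc _ ≤ ((Real.Gamma b)⁻¹ * t ^ (b - 1)) * (π / t) ^ s := by
              gcongr; exact bw_le hb ht0
          _ = _ := by
              rw [Real.div_rpow (by positivity) ht0.le, show -β - 1 = (b - 1) - s by linarith,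
                Real.rpow_sub ht0 (b - 1) s]
              ring
    _ = _ := by
        rw [← ofReal_integral_eq_lintegral_ofReal hI]
        · rw [integral_const_mul, integral_Ioi_rpow_of_lt (by linarith) hT]
          congr 1
          rw [show -β - 1 + 1 = -β by ring]
          field_simp
        · rw [Filter.EventuallyLE, ae_restrict_iff' measurableSet_Ioi]
          filter_upwards with t ht
          have ht0 : 0 < t := hT.trans ht
          simp only [Pi.zero_apply]
          positivity

lemma far_bound {b β r T : ℝ} (hb : 0 < b) (hβ : 0 < β) (hs : b + β = (d : ℝ) / (2 * r))
    (hr : 1 < r) (hT : 0 < T) {g : EuclideanSpace ℝ (Fin d) → ℂ} (hg : Measurable g)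
    (x : EuclideanSpace ℝ (Fin d)) :
    ‖∫ y, (mixK (volume.restrict (Set.Ioi T)) (bw b) id y : ℂ) * g (x - y)‖ₑ ≤
      ENNReal.ofReal ((Real.Gamma b)⁻¹ * π ^ ((d : ℝ) / (2 * r)) * β⁻¹ * T ^ (-β)) *
        (∫⁻ y, ‖g y‖ₑ ^ r) ^ (1 / r) := by
  have hbm : Measurable (bw b) := by unfold bw; fun_prop
  have hmeas : Measurable (fun p : EuclideanSpace ℝ (Fin d) × ℝ =>
      ENNReal.ofReal (bw b p.2) * (ENNReal.ofReal (heat p.2 p.1) * ‖g (x - p.1)‖ₑ)) := by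
    have h1 : Measurable (fun p : EuclideanSpace ℝ (Fin d) × ℝ => heat p.2 p.1) :=
      heat_measurable.comp measurable_swap
    have h2 : Measurable (fun p : EuclideanSpace ℝ (Fin d) × ℝ => g (x - p.1)) :=
      hg.comp (by fun_prop)
    exact (hbm.comp measurable_snd).ennreal_ofReal.mul (h1.ennreal_ofReal.mul h2.enorm)
  calc _ ≤ ∫⁻ y, ‖(mixK (volume.restrict (Set.Ioi T)) (bw b) id y : ℂ) * g (x - y)‖ₑ :=
        enorm_integral_le_lintegral_enorm _
    _ ≤ ∫⁻ y, ∫⁻ t in Set.Ioi T,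
          ENNReal.ofReal (bw b t) * (ENNReal.ofReal (heat t y) * ‖g (x - y)‖ₑ) := by
        apply lintegral_mono
        intro y
        simp only
        rw [enorm_mul]
        have h1 : ‖(mixK (volume.restrict (Set.Ioi T)) (bw b) id y : ℂ)‖ₑ ≤
            ∫⁻ t in Set.Ioi T, ENNReal.ofReal (bw b t) * ENNReal.ofReal (heat t y) := by
          have : ‖(mixK (volume.restrict (Set.Ioi T)) (bw b) id y : ℂ)‖ₑ =
            ‖mixK (volume.restrict (Set.Ioi T)) (bw b) id y‖ₑ := by
            rw [← ofReal_norm, ← ofReal_norm, Complex.norm_real]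
          rw [this]
          unfold mixK
          refine (enorm_integral_le_lintegral_enorm _).trans ?_
          apply setLIntegral_mono' measurableSet_Ioi
          intro t ht
          have ht0 : 0 < t := hT.trans ht
          rw [enorm_mul, Real.enorm_of_nonneg (bw_nonneg hb ht0)]
          simp only [id]
          rw [Real.enorm_of_nonneg (heat_nonneg ht0 y)]
        refine (mul_le_mul_left h1 _).trans (le_of_eq ?_)
        rw [← lintegral_mul_const'' ]
        · simp only [mul_assoc]
        · apply Measurable.aemeasurable
          have h1 : Measurable (fun t : ℝ => heat t y) :=
            heat_measurable.comp (measurable_id.prodMk measurable_const)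
          exact hbm.ennreal_ofReal.mul h1.ennreal_ofReal
    _ = ∫⁻ t in Set.Ioi T, ∫⁻ y,
          ENNReal.ofReal (bw b t) * (ENNReal.ofReal (heat t y) * ‖g (x - y)‖ₑ) :=
        lintegral_lintegral_swap hmeas.aemeasurable
    _ ≤ ∫⁻ t in Set.Ioi T, ENNReal.ofReal (bw b t) *
          ENNReal.ofReal ((π / t) ^ ((d : ℝ) / (2 * r))) * (∫⁻ y, ‖g y‖ₑ ^ r) ^ (1 / r) := by
        apply setLIntegral_mono' measurableSet_Ioi
        intro t ht
        have ht0 : 0 < t := hT.trans ht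
        rw [lintegral_const_mul' _ _ ENNReal.ofReal_ne_top, mul_assoc]
        gcongr
        have hm : Measurable (fun y => ‖g (x - y)‖ₑ) := (hg.comp (by fun_prop)).enorm
        refine (heat_holder ht0 hr hm).trans (le_of_eq ?_)
        congr 2
        exact lintegral_sub_left_eq_self (fun y => ‖g y‖ₑ ^ r) x
    _ ≤ _ := by
        rw [lintegral_mul_const'' ]
        · gcongr
          exact bw_far hb hβ hs hT
        · apply Measurable.aemeasurable
          exact hbm.ennreal_ofReal.mul (by fun_prop)

lemma decG {b β r : ℝ} (hb : 0 < b) (hβ : 0 < β) (hs : b + β = (d : ℝ) / (2 * r))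
    (hr : 1 < r) :
    ∃ A B : ℝ, 0 < A ∧ 0 < B ∧ ∀ u g : SchwartzMap (EuclideanSpace ℝ (Fin d)) ℂ,
      (∀ ξ, 𝓕 (⇑g) ξ = (((1 + ‖ξ‖ ^ 2) ^ b : ℝ) : ℂ) * 𝓕 (⇑u) ξ) →
      ∀ M : ℝ, 0 ≤ M → (∫⁻ y, ‖g y‖ₑ ^ r) ^ (1 / r) ≤ ENNReal.ofReal M → Dec u g b β A B M := by
  have hG := Real.Gamma_pos_of_pos hb
  refine ⟨(Real.Gamma b)⁻¹ * π ^ ((d : ℝ) / (2 * r)) * β⁻¹, (Real.Gamma b)⁻¹ * b⁻¹,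
    by positivity, by positivity, fun u g hg M hM0 hM T hT => ?_⟩
  have hi : IntegrableOn (bw b) (Set.Ioi T) :=
    (bw_integrable hb).mono_set (Set.Ioi_subset_Ioi hT.le)
  have hi2 : IntegrableOn (bw b) (Set.Ioc 0 T) :=
    (bw_integrable hb).mono_set Set.Ioc_subset_Ioi_self
  have hp : ∀ᵐ t ∂(volume.restrict (Set.Ioi T)), 0 < id t := by
    rw [ae_restrict_iff' measurableSet_Ioi]
    exact Filter.Eventually.of_forall fun t ht => hT.trans ht
  have hp2 : ∀ᵐ t ∂(volume.restrict (Set.Ioc 0 T)), 0 < id t := by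
    rw [ae_restrict_iff' measurableSet_Ioc]
    exact Filter.Eventually.of_forall fun t ht => ht.1
  have hk₁ := (mixK_integrable (d := d) hi measurable_id hp).ofReal (𝕜 := ℂ)
  have hk₂ := (mixK_integrable (d := d) hi2 measurable_id hp2).ofReal (𝕜 := ℂ)
  have hb₂ := mixK_norm (d := d) hi2 measurable_id hp2
  obtain ⟨k, hkm, hkb, hk⟩ := near_kernel hk₂ (B := (Real.Gamma b)⁻¹ * b⁻¹ * T ^ b) (by
    simpa using hb₂.trans (bw_near hb hT))
  refine ⟨k, hkm, hkb, fun x => ?_⟩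
  have hrep := kernel_rep hk₁ hk₂ (mixK_fourier hi measurable_id hp)
    (mixK_fourier hi2 measurable_id hp2) g g u (fun ξ => by
    rw [hg, ← add_mul, ← mul_assoc, ← Complex.ofReal_add, ← Complex.ofReal_mul]
    have hL : 0 < 1 + ‖ξ‖ ^ 2 := by positivity
    have h1 : (∫ t in Set.Ioi T, bw b t * rexp (-id t * ‖ξ‖ ^ 2)) +
        ∫ t in Set.Ioc 0 T, bw b t * rexp (-id t * ‖ξ‖ ^ 2) = (1 + ‖ξ‖ ^ 2) ^ (-b) := by
      have hE := bw_int_exp hb (sq_nonneg ‖ξ‖)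
      simp only [id]
      rw [← bw_val hb (sq_nonneg ‖ξ‖), add_comm, ← setIntegral_union _ measurableSet_Ioi
        (hE.mono_set Set.Ioc_subset_Ioi_self) (hE.mono_set (Set.Ioi_subset_Ioi hT.le)),
        Set.Ioc_union_Ioi_eq_Ioi hT.le]
      exact Set.Ioc_disjoint_Ioi le_rfl
    rw [h1, ← Real.rpow_add hL]
    simp) x
  rw [hrep]
  refine (enorm_add_le _ _).trans (add_le_add ?_ (hk _ x))
  refine (far_bound hb hβ hs hr hT g.continuous.measurable x).trans ?_
  exact (mul_le_mul_right hM _).trans_eq (ENNReal.ofReal_mul (by positivity)).symm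

end GNaux


namespace GNaux

variable {d : ℕ}

lemma exists_mult (s : ℝ) (u : SchwartzMap (EuclideanSpace ℝ (Fin d)) ℂ) :
    ∃ f : SchwartzMap (EuclideanSpace ℝ (Fin d)) ℂ,
      (∀ ξ, 𝓕 (⇑f) ξ = (((1 + ‖ξ‖ ^ 2) ^ s : ℝ) : ℂ) * 𝓕 (⇑u) ξ) ∧
      (fun x => 𝓕⁻ (fun ξ => (((1 + ‖ξ‖ ^ 2) ^ s : ℝ) : ℂ) * 𝓕 (⇑u) ξ) x) = ⇑f := by
  have ht := Function.hasTemperateGrowth_one_add_norm_sq_rpow (EuclideanSpace ℝ (Fin d)) s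
  set φ := SchwartzMap.smulLeftCLM ℂ (fun ξ : EuclideanSpace ℝ (Fin d) => (1 + ‖ξ‖ ^ 2) ^ s) (𝓕 u)
    with hφ
  have h1 : (⇑φ) = fun ξ => (((1 + ‖ξ‖ ^ 2) ^ s : ℝ) : ℂ) * 𝓕 (⇑u) ξ := by
    ext ξ
    rw [hφ, SchwartzMap.smulLeftCLM_apply_apply ht, SchwartzMap.fourier_coe]
    simp
  refine ⟨𝓕⁻ φ, fun ξ => ?_, ?_⟩
  · rw [← SchwartzMap.fourier_coe]
    have : 𝓕 (𝓕⁻ φ) = φ := by simp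
    rw [this, h1]
  · rw [SchwartzMap.fourierInv_coe, h1]

lemma dec_bound {b β r q A B : ℝ} (hβ : 0 < β) (hr : 1 < r) (hq : r < q)
    (hbq : 1 + b / β = q / r) (hA : 0 < A) (hB : 0 < B) :
    ∃ C : ℝ, 0 < C ∧ ∀ u g : SchwartzMap (EuclideanSpace ℝ (Fin d)) ℂ, ∀ M : ℝ, 0 ≤ M →
      Dec u g b β A B M →
      ∫⁻ x, ‖u x‖ₑ ^ q ≤ ENNReal.ofReal C * ENNReal.ofReal M ^ (q - r) * ∫⁻ x, ‖g x‖ₑ ^ r := by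
  have hr0 : 0 < r := by linarith
  have hr1 : 0 < r - 1 := by linarith
  have hqr : 0 < q - r := by linarith
  refine ⟨3 ^ q * (r / (r - 1)) * B ^ r * A ^ (q - r), by positivity, fun u g M hM hD => ?_⟩
  have hR : ∫⁻ x, ‖g x‖ₑ ^ r ≠ ⊤ := by
    have := (g.memLp (ENNReal.ofReal r)).eLpNorm_lt_top
    rw [eLpNorm_lt_top_iff_lintegral_rpow_enorm_lt_top (by simpa using hr0) (by simp),
      ENNReal.toReal_ofReal hr0.le] at this
    exact this.ne
  have key : ∀ M' : ℝ, M < M' → ∫⁻ x, ‖u x‖ₑ ^ q ≤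
      ENNReal.ofReal (3 ^ q * (r / (r - 1)) * B ^ r * A ^ (q - r)) *
        ENNReal.ofReal M' ^ (q - r) * ∫⁻ x, ‖g x‖ₑ ^ r := by
    intro M' hMM
    have hM' : 0 < M' := by linarith
    set K := A * M' with hK
    have hK0 : 0 < K := by positivity
    have := level_set (c := (B * K ^ (b / β))⁻¹) u.continuous.measurable g.continuous.measurable
      hr hq (by positivity) (fun lam hl => by
        obtain ⟨k, h1, h2, h3⟩ := hD ((K / lam) ^ (1 / β)) (by positivity)
        refine ⟨k, h1, h2.trans (le_of_eq ?_), fun x => (h3 x).trans ?_⟩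
        · congr 1
          rw [← Real.rpow_mul (by positivity), one_div_mul_eq_div, ← hbq,
            Real.rpow_add hl, Real.rpow_one, Real.div_rpow hK0.le hl.le]
          have := Real.rpow_pos_of_pos hl (b / β)
          field_simp
        · gcongr
          rw [← Real.rpow_mul (by positivity), show 1 / β * -β = -1 by field_simp,
            Real.rpow_neg_one, inv_div]
          calc A * (lam / K) * M ≤ A * (lam / K) * M' := by gcongr
            _ = lam := by rw [hK]; field_simp)
    refine this.trans (le_of_eq ?_)
    congr 1
    rw [ENNReal.ofReal_rpow_of_nonneg hM'.le hqr.le, ← ENNReal.ofReal_mul (by positivity)]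
    congr 1
    rw [inv_inv, Real.mul_rpow hB.le (by positivity), ← Real.rpow_mul hK0.le,
      show b / β * r = q - r by
        have : b / β = q / r - 1 := by linarith
        rw [this]; field_simp,
      hK, Real.mul_rpow hA.le hM'.le]
    ring
  have hlim : Filter.Tendsto (fun M' : ℝ =>
      ENNReal.ofReal (3 ^ q * (r / (r - 1)) * B ^ r * A ^ (q - r)) *
        ENNReal.ofReal M' ^ (q - r) * ∫⁻ x, ‖g x‖ₑ ^ r) (nhdsWithin M (Set.Ioi M))
      (nhds (ENNReal.ofReal (3 ^ q * (r / (r - 1)) * B ^ r * A ^ (q - r)) *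
        ENNReal.ofReal M ^ (q - r) * ∫⁻ x, ‖g x‖ₑ ^ r)) := by
    apply ENNReal.Tendsto.mul_const _ (Or.inr hR)
    apply ENNReal.Tendsto.const_mul _ (Or.inr ENNReal.ofReal_ne_top)
    have h1 : Continuous (fun M' : ℝ => ENNReal.ofReal M' ^ (q - r)) :=
      ENNReal.continuous_rpow_const.comp ENNReal.continuous_ofReal
    exact (h1.tendsto M).mono_left nhdsWithin_le_nhds
  refine ge_of_tendsto hlim ?_
  filter_upwards [self_mem_nhdsWithin] with M' hM'
  exact key M' hM'

lemma sup_bound (f : SchwartzMap (EuclideanSpace ℝ (Fin d)) ℂ) (x : EuclideanSpace ℝ (Fin d)) :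
    ‖f x‖ ≤ (eLpNorm (⇑f) ⊤ volume).toReal := by
  have hfin := f.memLp_top (μ := volume) |>.eLpNorm_ne_top
  have hd := MeasureTheory.Measure.dense_of_ae (enorm_ae_le_eLpNormEssSup (⇑f) volume)
  have hc : IsClosed {y | ‖f y‖ₑ ≤ eLpNormEssSup (⇑f) volume} :=
    isClosed_le f.continuous.enorm continuous_const
  have hx : x ∈ {y | ‖f y‖ₑ ≤ eLpNormEssSup (⇑f) volume} := by
    rw [← hc.closure_eq]; exact hd x
  have hx' : ‖f x‖ₑ ≤ eLpNorm (⇑f) ⊤ volume := by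
    rw [eLpNorm_exponent_top]; exact hx
  rw [← toReal_enorm]
  exact ENNReal.toReal_mono hfin hx'

end GNaux

/-- Endpoint Gagliardo-Nirenberg inequality in the case `1 < r₁ < q`, `r₂ = ∞`
(Proposition `prop:LargeFreqInterpolated`). -/
theorem gagliardo_nirenberg_endpoint_r_infty
    (d : ℕ) (hd : 1 ≤ d) (r₁ q : ℝ) (hr₁ : 1 < r₁) (hrq : r₁ < q)
    (κ : ℝ) (hκ1 : r₁ / q ≤ κ) (hκ2 : κ ≤ 1) :
    ∃ C : ℝ, 0 < C ∧ ∀ u : SchwartzMap (EuclideanSpace ℝ (Fin d)) ℂ,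
      eLpNorm (⇑u) (ENNReal.ofReal q) volume ≤ ENNReal.ofReal C *
        eLpNorm (fun x => 𝓕⁻ (fun ξ =>
          (((1 + ‖ξ‖ ^ 2) ^ ((-(d / q)) / 2) : ℝ) : ℂ) * 𝓕 (⇑u) ξ) x) ⊤ volume ^ (1 - κ) *
        eLpNorm (fun x => 𝓕⁻ (fun ξ =>
          (((1 + ‖ξ‖ ^ 2) ^ ((d * (1 / r₁ - 1 / q)) / 2) : ℝ) : ℂ) * 𝓕 (⇑u) ξ) x)
          (ENNReal.ofReal r₁) volume ^ κ := by
  have hr0 : 0 < r₁ := by linarith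
  have hq0 : 0 < q := by linarith
  have hqr : 0 < q - r₁ := by linarith
  have hd0 : (0 : ℝ) < d := by exact_mod_cast hd
  obtain ⟨β, hβd⟩ : ∃ β : ℝ, β = d / (2 * q) := ⟨_, rfl⟩
  obtain ⟨b, hbd⟩ : ∃ b : ℝ, b = (d * (1 / r₁ - 1 / q)) / 2 := ⟨_, rfl⟩
  have hβ : 0 < β := by rw [hβd]; positivity
  have hb : 0 < b := by
    rw [hbd]
    have : 1 / q < 1 / r₁ := one_div_lt_one_div_of_lt hr0 hrq
    have : 0 < 1 / r₁ - 1 / q := by linarith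
    positivity
  have hs : b + β = (d : ℝ) / (2 * r₁) := by
    rw [hbd, hβd]; field_simp; ring
  have hbq : 1 + b / β = q / r₁ := by
    rw [hbd, hβd]; field_simp; ring
  have hexp : (-((d : ℝ) / q)) / 2 = -β := by rw [hβd]; field_simp
  rw [hexp, ← hbd]
  obtain ⟨A₁, B₁, hA₁, hB₁, H₁⟩ := GNaux.decF (d := d) hb hβ
  obtain ⟨A₂, B₂, hA₂, hB₂, H₂⟩ := GNaux.decG (d := d) hb hβ hs hr₁
  obtain ⟨C₁, hC₁, K₁⟩ := GNaux.dec_bound (d := d) hβ hr₁ hrq hbq hA₁ hB₁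
  obtain ⟨C₂, hC₂, K₂⟩ := GNaux.dec_bound (d := d) hβ hr₁ hrq hbq hA₂ hB₂
  obtain ⟨α, hα⟩ : ∃ α : ℝ, α = (1 - κ) / (q - r₁) := ⟨_, rfl⟩
  obtain ⟨γ, hγ⟩ : ∃ γ : ℝ, γ = 1 / q - α := ⟨_, rfl⟩
  have hα0 : 0 ≤ α := by rw [hα]; exact div_nonneg (by linarith) hqr.le
  have hγ0 : 0 ≤ γ := by
    rw [hγ, hα, sub_nonneg, div_le_div_iff₀ hqr hq0]
    rw [div_le_iff₀ hq0] at hκ1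
    nlinarith
  have hαe : (q - r₁) * α = 1 - κ := by rw [hα]; field_simp
  have hqi : q * (1 / q) = 1 := by field_simp
  refine ⟨C₁ ^ α * C₂ ^ γ, by positivity, fun u => ?_⟩
  obtain ⟨f, hf, hf'⟩ := GNaux.exists_mult (-β) u
  obtain ⟨g, hg, hg'⟩ := GNaux.exists_mult b u
  rw [hf', hg']
  have hF := (f.memLp_top (μ := volume)).eLpNorm_ne_top
  have hN := (g.memLp (ENNReal.ofReal r₁)).eLpNorm_ne_top
  have hNe : eLpNorm (⇑g) (ENNReal.ofReal r₁) volume = (∫⁻ y, ‖g y‖ₑ ^ r₁) ^ (1 / r₁) := by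
    rw [eLpNorm_eq_lintegral_rpow_enorm_toReal (by simpa using hr0) (by simp),
      ENNReal.toReal_ofReal hr0.le]
  have hPe : eLpNorm (⇑u) (ENNReal.ofReal q) volume = (∫⁻ y, ‖u y‖ₑ ^ q) ^ (1 / q) := by
    rw [eLpNorm_eq_lintegral_rpow_enorm_toReal (by simpa using hq0) (by simp),
      ENNReal.toReal_ofReal hq0.le]
  have hRe : ∫⁻ y, ‖g y‖ₑ ^ r₁ = eLpNorm (⇑g) (ENNReal.ofReal r₁) volume ^ r₁ := by
    rw [hNe, ← ENNReal.rpow_mul, one_div_mul_cancel hr0.ne', ENNReal.rpow_one]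
  have e₁ := K₁ u g _ ENNReal.toReal_nonneg (H₁ u f g hf hg _ (GNaux.sup_bound f))
  have e₂ := K₂ u g (eLpNorm (⇑g) (ENNReal.ofReal r₁) volume).toReal ENNReal.toReal_nonneg
    (H₂ u g hg _ ENNReal.toReal_nonneg (by rw [ENNReal.ofReal_toReal hN, hNe]))
  rw [ENNReal.ofReal_toReal hF, hRe] at e₁
  rw [ENNReal.ofReal_toReal hN, hRe] at e₂
  rw [hPe]
  generalize (∫⁻ y, ‖u y‖ₑ ^ q) = P at e₁ e₂ ⊢
  generalize eLpNorm (⇑f) ⊤ volume = F at e₁ ⊢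
  generalize eLpNorm (⇑g) (ENNReal.ofReal r₁) volume = N at e₁ e₂ ⊢
  rw [mul_assoc, ← ENNReal.rpow_add_of_nonneg _ _ hqr.le hr0.le, sub_add_cancel] at e₂
  have hsum : 1 / q = α + γ := by rw [hγ]; ring
  have hκe : r₁ * α + q * γ = κ := by
    rw [hγ, mul_sub, hqi]; linarith
  calc P ^ (1 / q) = P ^ α * P ^ γ := by rw [hsum, ENNReal.rpow_add_of_nonneg _ _ hα0 hγ0]
    _ ≤ (ENNReal.ofReal C₁ * F ^ (q - r₁) * N ^ r₁) ^ α * (ENNReal.ofReal C₂ * N ^ q) ^ γ := by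
        gcongr
    _ = (ENNReal.ofReal C₁ ^ α * ENNReal.ofReal C₂ ^ γ) * F ^ ((q - r₁) * α) *
          (N ^ (r₁ * α) * N ^ (q * γ)) := by
        rw [ENNReal.mul_rpow_of_nonneg _ _ hα0, ENNReal.mul_rpow_of_nonneg _ _ hα0,
          ENNReal.mul_rpow_of_nonneg _ _ hγ0, ENNReal.rpow_mul, ENNReal.rpow_mul, ENNReal.rpow_mul]
        ring
    _ = _ := by
        rw [← ENNReal.rpow_add_of_nonneg _ _ (by positivity) (by positivity), hκe, hαe,
          ENNReal.ofReal_rpow_of_nonneg hC₁.le hα0, ENNReal.ofReal_rpow_of_nonneg hC₂.le hγ0,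
          ENNReal.ofReal_mul (by positivity)]
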